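/- Suppose n is odd and that (A,B) and (C,D) are equivalent symmetric near-factorizations of Z_{2n}. Let (A',B') and (C',D') be obtained from (A,B) and (C,D) respectively by applying the Pêcher transform. Then (A',B') and (C',D') are equivalent strongly symmetric near-factorizations of the dihedral group D_n. -/

import Mathlib

open Pointwise

/-- The Pêcher transform sends `x ∈ Z_{2n}` to `a^{x mod 2} b^{x mod n} ∈ D_n`. -/
def pecher (n : ℕ) (x : ZMod (2 * n)) : DihedralGroup n :=
  if x.val % 2 = 0 then DihedralGroup.r (x.val : ZMod n)
  else DihedralGroup.sr (x.val : ZMod n)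

/-- A subset `X` of `D_n` is strongly symmetric if `a^i b^j ∈ X ↔ a^i b^{-j} ∈ X`. -/
def StronglySymmetric {n : ℕ} (X : Finset (DihedralGroup n)) : Prop :=
  ∀ j : ZMod n, (DihedralGroup.r j ∈ X ↔ DihedralGroup.r (-j) ∈ X) ∧
    (DihedralGroup.sr j ∈ X ↔ DihedralGroup.sr (-j) ∈ X)

theorem dcast (n : ℕ) : n ∣ 2 * n := Dvd.intro_left 2 rfl
theorem dcast2 (n : ℕ) : 2 ∣ 2 * n := Dvd.intro n rfl

/-- reduction mod n -/
def cc (n : ℕ) : ZMod (2 * n) →+* ZMod n := ZMod.castHom (dcast n) (ZMod n)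
/-- reduction mod 2 -/
def pp (n : ℕ) : ZMod (2 * n) →+* ZMod 2 := ZMod.castHom (dcast2 n) (ZMod 2)

theorem cc_val (n : ℕ) [NeZero n] (x : ZMod (2 * n)) : cc n x = (x.val : ZMod n) := by
  have : cc n ((x.val : ℕ) : ZMod (2 * n)) = (x.val : ZMod n) := map_natCast _ _
  rwa [ZMod.natCast_zmod_val] at this

theorem pp_val (n : ℕ) [NeZero n] (x : ZMod (2 * n)) : pp n x = (x.val : ZMod 2) := by
  have : pp n ((x.val : ℕ) : ZMod (2 * n)) = (x.val : ZMod 2) := map_natCast _ _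
  rwa [ZMod.natCast_zmod_val] at this

theorem zmod2_cases (u : ZMod 2) : u = 0 ∨ u = 1 := by
  revert u; decide

theorem pecher_even (n : ℕ) [NeZero n] (x : ZMod (2 * n)) (h : pp n x = 0) :
    pecher n x = DihedralGroup.r (cc n x) := by
  rw [pp_val, ZMod.natCast_eq_zero_iff] at h
  rw [pecher, if_pos (Nat.mod_eq_zero_of_dvd h), cc_val]

theorem pecher_odd (n : ℕ) [NeZero n] (x : ZMod (2 * n)) (h : pp n x = 1) :
    pecher n x = DihedralGroup.sr (cc n x) := by
  have h0 : ¬ x.val % 2 = 0 := by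
    intro h'
    have : pp n x = 0 := by
      rw [pp_val, ZMod.natCast_eq_zero_iff]; exact Nat.dvd_of_mod_eq_zero h'
    rw [this] at h
    exact absurd h (by decide)
  rw [pecher, if_neg h0, cc_val]

theorem crt_zero (n : ℕ) [NeZero n] (hodd : Odd n) (z : ZMod (2 * n)) (h1 : pp n z = 0)
    (h2 : cc n z = 0) : z = 0 := by
  rw [pp_val, ZMod.natCast_eq_zero_iff] at h1
  rw [cc_val, ZMod.natCast_eq_zero_iff] at h2
  have h : 2 * n ∣ z.val :=
    Nat.Coprime.mul_dvd_of_dvd_of_dvd (Nat.coprime_two_left.mpr hodd) h1 h2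
  rw [← ZMod.natCast_zmod_val z, ZMod.natCast_eq_zero_iff]
  exact h

theorem pecher_inj (n : ℕ) [NeZero n] (hodd : Odd n) : Function.Injective (pecher n) := by
  intro x y h
  have key : pp n x = pp n y ∧ cc n x = cc n y := by
    rcases zmod2_cases (pp n x) with hx | hx <;> rcases zmod2_cases (pp n y) with hy | hy
    · rw [pecher_even n x hx, pecher_even n y hy] at h
      exact ⟨hx.trans hy.symm, by simpa using h⟩
    · rw [pecher_even n x hx, pecher_odd n y hy] at h; cases h
    · rw [pecher_odd n x hx, pecher_even n y hy] at h; cases h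
    · rw [pecher_odd n x hx, pecher_odd n y hy] at h
      exact ⟨hx.trans hy.symm, by simpa using h⟩
  rw [← sub_eq_zero]
  exact crt_zero n hodd _ (by rw [map_sub, key.1, sub_self]) (by rw [map_sub, key.2, sub_self])

theorem pecher_bij (n : ℕ) [NeZero n] (hodd : Odd n) : Function.Bijective (pecher n) := by
  rw [Fintype.bijective_iff_injective_and_card]
  exact ⟨pecher_inj n hodd, by rw [ZMod.card, DihedralGroup.card]⟩

theorem pecher_zero (n : ℕ) [NeZero n] : pecher n 0 = 1 := by
  rw [pecher_even n 0 (map_zero _), map_zero]; rfl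

theorem pecher_mul_even (n : ℕ) [NeZero n] (x y : ZMod (2 * n)) (hy : pp n y = 0) :
    pecher n x * pecher n y = pecher n (x + y) := by
  rcases zmod2_cases (pp n x) with hx | hx
  · rw [pecher_even n x hx, pecher_even n y hy,
      pecher_even n (x + y) (by rw [map_add, hx, hy, add_zero]), map_add]; simp
  · rw [pecher_odd n x hx, pecher_even n y hy,
      pecher_odd n (x + y) (by rw [map_add, hx, hy, add_zero]), map_add]; simp

theorem pecher_mul_odd (n : ℕ) [NeZero n] (x y : ZMod (2 * n)) (hy : pp n y = 1) :
    pecher n x * pecher n y = pecher n (-x + y) := by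
  rcases zmod2_cases (pp n x) with hx | hx
  · rw [pecher_even n x hx, pecher_odd n y hy,
      pecher_odd n (-x + y) (by rw [map_add, map_neg, hx, hy]; decide), map_add, map_neg]
    simp [sub_eq_add_neg, add_comm]
  · rw [pecher_odd n x hx, pecher_odd n y hy,
      pecher_even n (-x + y) (by rw [map_add, map_neg, hx, hy]; decide), map_add, map_neg]
    simp [sub_eq_add_neg, add_comm]

theorem neg_mem_of_sym {n : ℕ} {A : Finset (ZMod (2 * n))} (hA : A = -A) {x : ZMod (2 * n)}
    (hx : x ∈ A) : -x ∈ A := by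
  rw [hA]; exact Finset.neg_mem_neg hx

theorem image_mul_pecher (n : ℕ) [NeZero n] (A B : Finset (ZMod (2 * n))) (hA : A = -A) :
    A.image (pecher n) * B.image (pecher n) = (A + B).image (pecher n) := by
  ext g
  simp only [Finset.mem_mul, Finset.mem_image, Finset.mem_add]
  constructor
  · rintro ⟨_, ⟨x, hx, rfl⟩, _, ⟨y, hy, rfl⟩, rfl⟩
    rcases zmod2_cases (pp n y) with h | h
    · exact ⟨x + y, ⟨x, hx, y, hy, rfl⟩, (pecher_mul_even n x y h).symm⟩
    · exact ⟨-x + y, ⟨-x, neg_mem_of_sym hA hx, y, hy, rfl⟩, (pecher_mul_odd n x y h).symm⟩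
  · rintro ⟨_, ⟨x, hx, y, hy, rfl⟩, rfl⟩
    rcases zmod2_cases (pp n y) with h | h
    · exact ⟨_, ⟨x, hx, rfl⟩, _, ⟨y, hy, rfl⟩, pecher_mul_even n x y h⟩
    · exact ⟨_, ⟨-x, neg_mem_of_sym hA hx, rfl⟩, _, ⟨y, hy, rfl⟩, by
        rw [pecher_mul_odd n _ y h, neg_neg]⟩

theorem nf_pecher (n : ℕ) [NeZero n] (hodd : Odd n) (A B : Finset (ZMod (2 * n)))
    (hNF : A.card * B.card = 2 * n - 1 ∧ A + B = Finset.univ \ {0}) (hA : A = -A) :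
    (A.image (pecher n)).card * (B.image (pecher n)).card = 2 * n - 1 ∧
      A.image (pecher n) * B.image (pecher n) = Finset.univ \ {1} := by
  refine ⟨?_, ?_⟩
  · rw [Finset.card_image_of_injective _ (pecher_inj n hodd),
      Finset.card_image_of_injective _ (pecher_inj n hodd)]
    exact hNF.1
  · rw [image_mul_pecher n A B hA, hNF.2, Finset.image_sdiff _ _ (pecher_inj n hodd),
      Finset.image_singleton, pecher_zero, Finset.image_univ_of_surjective (pecher_bij n hodd).2]

theorem ss_pecher (n : ℕ) [NeZero n] (A : Finset (ZMod (2 * n))) (hA : A = -A) :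
    StronglySymmetric (A.image (pecher n)) := by
  have h1 : ∀ j : ZMod n, DihedralGroup.r j ∈ A.image (pecher n) →
      DihedralGroup.r (-j) ∈ A.image (pecher n) := by
    intro j hj
    obtain ⟨x, hx, hxj⟩ := Finset.mem_image.mp hj
    refine Finset.mem_image.mpr ⟨-x, neg_mem_of_sym hA hx, ?_⟩
    rcases zmod2_cases (pp n x) with h | h
    · rw [pecher_even n x h] at hxj
      rw [pecher_even n (-x) (by rw [map_neg, h, neg_zero]), map_neg]
      cases hxj; rfl
    · rw [pecher_odd n x h] at hxj; cases hxj
  have h2 : ∀ j : ZMod n, DihedralGroup.sr j ∈ A.image (pecher n) →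
      DihedralGroup.sr (-j) ∈ A.image (pecher n) := by
    intro j hj
    obtain ⟨x, hx, hxj⟩ := Finset.mem_image.mp hj
    refine Finset.mem_image.mpr ⟨-x, neg_mem_of_sym hA hx, ?_⟩
    rcases zmod2_cases (pp n x) with h | h
    · rw [pecher_even n x h] at hxj; cases hxj
    · rw [pecher_odd n x h] at hxj
      rw [pecher_odd n (-x) (by rw [map_neg, h]; decide), map_neg]
      cases hxj; rfl
  exact fun j => ⟨⟨h1 j, fun h => by simpa using h1 _ h⟩, ⟨h2 j, fun h => by simpa using h2 _ h⟩⟩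

/-- the automorphism `a^i b^j ↦ a^i b^{uj}` -/
def dihAut (n : ℕ) (u : (ZMod n)ˣ) : DihedralGroup n ≃* DihedralGroup n where
  toFun g := match g with
    | .r j => .r (u * j)
    | .sr j => .sr (u * j)
  invFun g := match g with
    | .r j => .r (↑u⁻¹ * j)
    | .sr j => .sr (↑u⁻¹ * j)
  left_inv g := by cases g <;> simp
  right_inv g := by cases g <;> simp
  map_mul' g k := by cases g <;> cases k <;> simp [mul_add, mul_sub]

theorem dihAut_pecher (n : ℕ) [NeZero n] (u : (ZMod n)ˣ) (r x : ZMod (2 * n))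
    (h1 : pp n r = 1) (h2 : cc n r = u) :
    dihAut n u (pecher n x) = pecher n (r * x) := by
  rcases zmod2_cases (pp n x) with h | h
  · rw [pecher_even n x h, pecher_even n (r * x) (by rw [map_mul, h, mul_zero]), map_mul, h2]
    rfl
  · rw [pecher_odd n x h, pecher_odd n (r * x) (by rw [map_mul, h, h1, mul_one]), map_mul, h2]
    rfl

theorem period_zero (n : ℕ) [NeZero n] (A B : Finset (ZMod (2 * n)))
    (h : A + B = Finset.univ \ {0}) (p : ZMod (2 * n)) (hp : ∀ x ∈ A, x + p ∈ A) : p = 0 := by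
  by_contra hne
  have hm : -p ∈ A + B := by rw [h]; simpa using hne
  obtain ⟨x, hx, y, hy, hxy⟩ := Finset.mem_add.mp hm
  have h0 : (0 : ZMod (2 * n)) ∈ A + B :=
    Finset.mem_add.mpr ⟨x + p, hp x hx, y, hy, by linear_combination hxy⟩
  rw [h] at h0
  simp at h0

/-- If `(A,B)` and `(C,D)` are equivalent symmetric near-factorizations of
`Z_{2n}` (`n` odd), then their images `(A',B')` and `(C',D')` under the Pêcher
transform are equivalent strongly symmetric near-factorizations of `D_n`. -/
theorem stmt12 (n : ℕ) [NeZero n] (hodd : Odd n)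
    (A B C D : Finset (ZMod (2 * n)))
    (hNF : A.card * B.card = 2 * n - 1 ∧ A + B = Finset.univ \ {0})
    (hNF' : C.card * D.card = 2 * n - 1 ∧ C + D = Finset.univ \ {0})
    (hsymA : A = -A) (hsymB : B = -B) (hsymC : C = -C) (hsymD : D = -D)
    (hEquiv : ∃ (r h : ℤ), Int.gcd r (2 * n) = 1 ∧
      C = A.image (fun x => (r : ZMod (2 * n)) * x + (h : ZMod (2 * n))) ∧
      D = B.image (fun x => (r : ZMod (2 * n)) * x - (h : ZMod (2 * n)))) :
    ((A.image (pecher n)).card * (B.image (pecher n)).card = 2 * n - 1 ∧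
      A.image (pecher n) * B.image (pecher n) = Finset.univ \ {1}) ∧
    StronglySymmetric (A.image (pecher n)) ∧ StronglySymmetric (B.image (pecher n)) ∧
    ((C.image (pecher n)).card * (D.image (pecher n)).card = 2 * n - 1 ∧
      C.image (pecher n) * D.image (pecher n) = Finset.univ \ {1}) ∧
    StronglySymmetric (C.image (pecher n)) ∧ StronglySymmetric (D.image (pecher n)) ∧
    ∃ (f : DihedralGroup n ≃* DihedralGroup n) (h' : DihedralGroup n),
      C.image (pecher n) = ((A.image (pecher n)).image f).image (· * h') ∧
      D.image (pecher n) = ((B.image (pecher n)).image f).image (h'⁻¹ * ·) := by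
  refine ⟨nf_pecher n hodd A B hNF hsymA, ss_pecher n A hsymA, ss_pecher n B hsymB,
    nf_pecher n hodd C D hNF' hsymC, ss_pecher n C hsymC, ss_pecher n D hsymD, ?_⟩
  obtain ⟨r, h, hg, hC, hD⟩ := hEquiv
  have hcop : IsCoprime r (2 * n : ℤ) := Int.isCoprime_iff_gcd_eq_one.mpr hg
  have hr2 : pp n (r : ZMod (2 * n)) = 1 := by
    rcases zmod2_cases (pp n (r : ZMod (2 * n))) with h0 | h0
    · exfalso
      obtain ⟨a, b, hab⟩ := hcop
      have := congrArg (fun z : ℤ => (z : ZMod 2)) hab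
      rw [map_intCast] at h0
      have h2 : (2 : ZMod 2) = 0 := by decide
      push_cast at this
      rw [h0, h2] at this
      simp at this
    · exact h0
  have hru : IsUnit (cc n (r : ZMod (2 * n))) := by
    obtain ⟨a, b, hab⟩ := hcop
    rw [map_intCast]
    have := congrArg (fun z : ℤ => (z : ZMod n)) hab
    push_cast at this
    rw [ZMod.natCast_self] at this
    exact IsUnit.of_mul_eq_one (a : ZMod n) (by linear_combination this)
  obtain ⟨u, hu⟩ := hru

  have h2h : (2 : ZMod (2 * n)) * (h : ZMod (2 * n)) = 0 := by
    refine period_zero n C D hNF'.2 _ ?_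
    intro x hx
    have hx' := neg_mem_of_sym hsymC hx
    rw [hC] at hx'
    obtain ⟨y, hy, hyx⟩ := Finset.mem_image.mp hx'
    rw [hC]
    exact Finset.mem_image.mpr ⟨-y, neg_mem_of_sym hsymA hy, by linear_combination -hyx⟩
  generalize (r : ZMod (2 * n)) = r at *
  generalize (h : ZMod (2 * n)) = h at *
  have hneg : -h = h := by linear_combination -h2h
  refine ⟨dihAut n u, pecher n h, ?_, ?_⟩
  · rw [hC]
    simp only [Finset.image_image]
    ext g
    simp only [Finset.mem_image, Function.comp]
    rcases zmod2_cases (pp n h) with hh | hh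
    · simp only [dihAut_pecher n u r _ hr2 hu.symm, pecher_mul_even n _ h hh]
    · simp only [dihAut_pecher n u r _ hr2 hu.symm, pecher_mul_odd n _ h hh]
      constructor
      · rintro ⟨x, hx, rfl⟩
        exact ⟨-x, neg_mem_of_sym hsymA hx, by congr 1; ring⟩
      · rintro ⟨x, hx, rfl⟩
        exact ⟨-x, neg_mem_of_sym hsymA hx, by congr 1; ring⟩
  · have key : ∀ z, (pecher n h)⁻¹ * pecher n z = pecher n (z - h) := by
      intro z
      rw [inv_mul_eq_iff_eq_mul]
      rcases zmod2_cases (pp n (z - h)) with hh | hh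
      · rw [pecher_mul_even n _ _ hh]; congr 1; ring
      · rw [pecher_mul_odd n _ _ hh, hneg]; congr 1; ring
    rw [hD]
    simp only [Finset.image_image]
    ext g
    simp only [Finset.mem_image, Function.comp, dihAut_pecher n u r _ hr2 hu.symm, key]
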